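/- There exists a self-dual binary linear code C ⊆ F₂^{72} whose minimum nonzero Hamming weight is 12, which contains exactly 600 codewords of Hamming weight 12 and exactly 7488 codewords of Hamming weight 14 (the weight enumerator W_{72,1} with γ = 18 and β = 300). -/

import Mathlib

/-- A subspace `C` of `(ZMod 2)^ι` is self-dual if it equals its Euclidean dual. -/
def IsSelfDual {R : Type*} [CommRing R] {ι : Type*} [Fintype ι]
    (C : Submodule R (ι → R)) : Prop :=
  ∀ x, x ∈ C ↔ ∀ y ∈ C, ∑ i, x i * y i = 0

/-- The Hamming weight of a vector: the number of nonzero coordinates. -/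
def hamWt {ι : Type*} [Fintype ι] {R : Type*} [Zero R] [DecidableEq R] (v : ι → R) : ℕ :=
  (Finset.univ.filter fun i => v i ≠ 0).card

namespace BitSlice

open Finset Matrix

/-! ### Bit vectors indexed by a list, stored as natural numbers -/

section Pack

variable {α β : Type*}

/-- The natural number whose binary digits, least significant first, are the values of `f`
on the list `l`. -/
def pack (l : List α) (f : α → Bool) : ℕ :=
  l.foldr (fun x n => Nat.bit (f x) n) 0

@[simp] lemma pack_nil (f : α → Bool) : pack [] f = 0 := rfl

@[simp] lemma pack_cons (x : α) (l : List α) (f : α → Bool) :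
    pack (x :: l) f = Nat.bit (f x) (pack l f) := rfl

lemma pack_map (g : α → β) (l : List α) (f : β → Bool) :
    pack (l.map g) f = pack l (f ∘ g) := by
  induction l with
  | nil => rfl
  | cons x l ih => simp [ih]

lemma pack_congr {l : List α} {f g : α → Bool} (h : ∀ x ∈ l, f x = g x) :
    pack l f = pack l g := by
  induction l with
  | nil => rfl
  | cons x l ih =>
    rw [pack_cons, pack_cons, h x (by simp), ih fun y hy => h y (by simp [hy])]

lemma pack_append (l m : List α) (f : α → Bool) :
    pack (l ++ m) f = pack l f + pack m f <<< l.length := by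
  induction l with
  | nil => simp
  | cons x l ih =>
    simp only [List.cons_append, pack_cons, ih, Nat.bit_val, List.length_cons,
      Nat.shiftLeft_eq, pow_succ]
    ring

lemma pack_add_pack_not (l : List α) (f : α → Bool) :
    pack l f + pack l (fun x => !f x) + 1 = 2 ^ l.length := by
  induction l with
  | nil => rfl
  | cons x l ih =>
    rw [List.length_cons, pow_succ, ← ih, pack_cons, pack_cons]
    cases f x <;> simp [Nat.bit_val] <;> ring

lemma pack_not (l : List α) (f : α → Bool) :
    pack l (fun x => !f x) = 2 ^ l.length - 1 - pack l f := by
  have := pack_add_pack_not l f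
  omega

lemma pack_false (l : List α) : pack l (fun _ => false) = 0 := by
  induction l with
  | nil => rfl
  | cons x l ih => simp [ih]

lemma pack_true (l : List α) : pack l (fun _ => true) = 2 ^ l.length - 1 := by
  have := pack_not l fun _ => false
  simpa [pack_false] using this

lemma pack_xor (l : List α) (f g : α → Bool) :
    pack l f ^^^ pack l g = pack l fun x => f x ^^ g x := by
  induction l with
  | nil => simp
  | cons x l ih => simp only [pack_cons, Nat.xor_bit, ih]

lemma pack_and (l : List α) (f g : α → Bool) :
    pack l f &&& pack l g = pack l fun x => f x && g x := by
  induction l with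
  | nil => simp
  | cons x l ih => simp only [pack_cons, Nat.land_bit, ih]

lemma pack_eq_zero {l : List α} {f : α → Bool} (h : pack l f = 0) :
    ∀ x ∈ l, f x = false := by
  induction l with
  | nil => simp
  | cons x l ih =>
    rw [pack_cons, Nat.bit_eq_zero_iff] at h
    simpa [h.2] using ih h.1

lemma sum_testBit_pack (l : List α) (f : α → Bool) {N : ℕ} (hN : l.length ≤ N) :
    ∑ i ∈ range N, ((pack l f).testBit i).toNat = l.countP f := by
  induction l generalizing N with
  | nil => simp
  | cons x l ih =>
    obtain ⟨N, rfl⟩ : ∃ m, N = m + 1 := ⟨N - 1, by simp at hN; omega⟩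
    rw [sum_range_succ', pack_cons, List.countP_cons]
    simp only [Nat.testBit_bit_succ, Nat.testBit_bit_zero]
    rw [ih (by simpa using hN)]
    cases f x <;> simp

end Pack

/-! ### Parities of all `w`-element sublists of a list of bits -/

/-- The sum modulo two of a list of bits. -/
def parity (c : List Bool) : Bool := c.foldr xor false

/-- Concatenation of two bit vectors, each given by its length and its value. -/
def appendBits (p q : ℕ × ℕ) : ℕ × ℕ := (p.1 + q.1, p.2 + q.2 <<< p.1)

/-- Addition of the constant `a` to a bit vector given by its length and its value. -/
def xorConst (a : Bool) (p : ℕ × ℕ) : ℕ × ℕ := (p.1, bif a then 2 ^ p.1 - 1 - p.2 else p.2)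

/-- One step of Pascal's triangle for bit vectors, `p` being the entry to the left of the
given part of a row. -/
def pascalStep (a : Bool) : ℕ × ℕ → List (ℕ × ℕ) → List (ℕ × ℕ)
  | _, [] => []
  | p, q :: qs => appendBits q (xorConst a p) :: pascalStep a q qs

/-- The parities of the `w`-element sublists of `c`, for `w = 1, …, k`. -/
def pascalRow (k : ℕ) (c : List Bool) : List (ℕ × ℕ) :=
  c.foldr (fun a r => pascalStep a (1, 0) r) (List.replicate k (0, 0))

/-- The parities of the `w`-element sublists of `c`, as a bit vector. -/
def parityPlane (c : List Bool) (w : ℕ) : ℕ := (((1, 0) :: pascalRow w c).getD w (0, 0)).2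

/-- The length and value of the bit vector of parities of the `w`-element sublists of `c`. -/
def sublistParities (c : List Bool) (w : ℕ) : ℕ × ℕ :=
  ((c.sublistsLen w).length, pack (c.sublistsLen w) parity)

lemma sublistParities_zero (c : List Bool) : sublistParities c 0 = (1, 0) := by
  simp [sublistParities, parity]

lemma sublistParities_cons_succ (a : Bool) (c : List Bool) (w : ℕ) :
    sublistParities (a :: c) (w + 1) =
      appendBits (sublistParities c (w + 1)) (xorConst a (sublistParities c w)) := by
  simp only [sublistParities, appendBits, xorConst, List.sublistsLen_succ_cons,
    List.length_append, List.length_map, pack_append, pack_map]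
  congr 3
  cases a
  · exact pack_congr fun x _ => by simp [parity]
  · rw [cond_true, ← pack_not]
    exact pack_congr fun x _ => by simp [parity]

lemma pascalStep_map (a : Bool) (c : List Bool) (k s : ℕ) :
    pascalStep a (sublistParities c s) ((List.range' (s + 1) k).map (sublistParities c)) =
      (List.range' (s + 1) k).map (sublistParities (a :: c)) := by
  induction k generalizing s with
  | zero => rfl
  | succ k ih =>
    simp only [List.range'_succ, List.map_cons, pascalStep, sublistParities_cons_succ, ih]

lemma pascalRow_eq (k : ℕ) (c : List Bool) :
    pascalRow k c = (List.range' 1 k).map (sublistParities c) := by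
  induction c with
  | nil =>
    refine List.ext_getElem (by simp [pascalRow]) fun i _ _ => ?_
    simp [pascalRow, sublistParities, Nat.add_comm 1 i]
  | cons a c ih =>
    rw [pascalRow, List.foldr_cons, ← pascalRow, ih, ← sublistParities_zero c]
    exact pascalStep_map a c k 0

lemma parityPlane_eq (c : List Bool) (w : ℕ) :
    parityPlane c w = pack (c.sublistsLen w) parity := by
  rw [parityPlane, pascalRow_eq]
  cases w with
  | zero => simp [parity]
  | succ w => simp [sublistParities, Nat.add_comm 1 w]

lemma sublistsLen_map {ι κ : Type*} (f : ι → κ) (l : List ι) (w : ℕ) :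
    (l.map f).sublistsLen w = (l.sublistsLen w).map (List.map f) := by
  induction l generalizing w with
  | nil => cases w <;> simp
  | cons x l ih => cases w <;> simp [List.sublistsLen_succ_cons, ih]

lemma parityPlane_map {ι : Type*} (f : ι → Bool) (l : List ι) (w : ℕ) :
    parityPlane (l.map f) w = pack (l.sublistsLen w) fun t => parity (t.map f) := by
  rw [parityPlane_eq, sublistsLen_map, pack_map]
  rfl

/-! ### Counters stored as bit planes -/

/-- Add a bit plane to a counter. -/
def addPlane : List ℕ → ℕ → List ℕ
  | [], f => bif f.beq 0 then [] else [f]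
  | s :: ss, f => (s ^^^ f) :: addPlane ss (s &&& f)

/-- The positions inside the mask `m` at which a counter has the value `b`. -/
def selectPlane : List ℕ → ℕ → ℕ → ℕ
  | [], b, m => bif b.beq 0 then m else 0
  | s :: ss, b, m => selectPlane ss (b / 2) (bif b.testBit 0 then m &&& s else m ^^^ (m &&& s))

/-- The number of ones among the `2 ^ d` lowest binary digits of `x`. -/
def popCount : ℕ → ℕ → ℕ
  | 0, x => x % 2
  | d + 1, x => bif x.beq 0 then 0 else popCount d (x % 2 ^ 2 ^ d) + popCount d (x >>> 2 ^ d)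

lemma popCount_eq (d x : ℕ) : popCount d x = ∑ i ∈ range (2 ^ d), (x.testBit i).toNat := by
  induction d generalizing x with
  | zero => simp [popCount, Nat.toNat_testBit]
  | succ d ih =>
    rw [popCount]
    rcases Nat.eq_zero_or_pos x with rfl | hx
    · simp
    · have h0 : x.beq 0 = false := by
        cases h : x.beq 0 with
        | true => exact absurd (Nat.eq_of_beq_eq_true h) hx.ne'
        | false => rfl
      rw [h0, cond_false, ih, ih, pow_succ, mul_two, sum_range_add]
      congr 1
      · refine sum_congr rfl fun i hi => ?_
        simp [Nat.testBit_mod_two_pow, mem_range.mp hi]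
      · simp [Nat.testBit_shiftRight]

section Planes

variable {α : Type*}

/-- The number with the given binary digits at `x`, least significant first. -/
def counterValue : List (α → Bool) → α → ℕ
  | [], _ => 0
  | f :: fs, x => (f x).toNat + 2 * counterValue fs x

/-- The list of bit planes `ss` stores the values of `g` on the list `l`. -/
def Stores (l : List α) (ss : List ℕ) (g : α → ℕ) : Prop :=
  ∃ fs : List (α → Bool), ss = fs.map (pack l) ∧ ∀ x ∈ l, counterValue fs x = g x

lemma stores_nil (l : List α) : Stores l [] fun _ => 0 := ⟨[], rfl, fun _ _ => rfl⟩

lemma Stores.addPlane {l : List α} {ss : List ℕ} {g : α → ℕ} (h : Stores l ss g)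
    (f : α → Bool) :
    Stores l (addPlane ss (pack l f)) fun x => g x + (f x).toNat := by
  obtain ⟨fs, rfl, hfs⟩ := h
  induction fs generalizing f g with
  | nil =>
    rw [List.map_nil, BitSlice.addPlane]
    cases hz : (pack l f).beq 0 with
    | true =>
      refine ⟨[], rfl, fun x hx => ?_⟩
      beta_reduce
      rw [← hfs x hx, pack_eq_zero (Nat.eq_of_beq_eq_true hz) x hx]
      rfl
    | false =>
      refine ⟨[f], rfl, fun x hx => ?_⟩
      simp [← hfs x hx, counterValue]
  | cons s fs ih =>
    obtain ⟨gs, h1, h2⟩ := ih (fun x => s x && f x) fun x _ => rfl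
    refine ⟨(fun x => s x ^^ f x) :: gs, ?_, fun x hx => ?_⟩
    · rw [List.map_cons, BitSlice.addPlane, pack_and, h1, pack_xor, List.map_cons]
    · beta_reduce
      rw [counterValue, h2 x hx, ← hfs x hx, counterValue]
      beta_reduce
      cases s x <;> cases f x <;> simp <;> omega

lemma Stores.selectPlane {l : List α} {ss : List ℕ} {g : α → ℕ} (h : Stores l ss g)
    (b : ℕ) (m : α → Bool) :
    selectPlane ss b (pack l m) = pack l fun x => m x && decide (g x = b) := by
  obtain ⟨fs, rfl, hfs⟩ := h
  induction fs generalizing b m g with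
  | nil =>
    rw [List.map_nil, BitSlice.selectPlane]
    cases hb : b.beq 0 with
    | true =>
      refine pack_congr fun x hx => ?_
      simp [← hfs x hx, Nat.eq_of_beq_eq_true hb, counterValue]
    | false =>
      rw [cond_false, ← pack_false l]
      refine pack_congr fun x hx => ?_
      simp [← hfs x hx, counterValue, Ne.symm (Nat.ne_of_beq_eq_false hb)]
  | cons s fs ih =>
    have key : (bif b.testBit 0 then pack l m &&& pack l s
        else pack l m ^^^ (pack l m &&& pack l s)) =
        pack l fun x => m x && (s x == b.testBit 0) := by
      cases b.testBit 0
      · rw [cond_false, pack_and, pack_xor]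
        refine pack_congr fun x _ => ?_
        cases m x <;> cases s x <;> rfl
      · rw [cond_true, pack_and]
        refine pack_congr fun x _ => ?_
        cases m x <;> cases s x <;> rfl
    rw [List.map_cons, BitSlice.selectPlane, key, ih _ _ fun x _ => rfl]
    refine pack_congr fun x hx => ?_
    rw [← hfs x hx, counterValue, Bool.and_assoc]
    congr 1
    rw [Bool.eq_iff_iff]
    simp only [Nat.testBit_zero, Bool.and_eq_true, beq_iff_eq, decide_eq_true_eq]
    cases s x <;> simp <;> omega

end Planes

/-! ### Counting sets of rows of a square bit matrix by the weight of their sum -/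

section Count

variable {n : ℕ}

/-- The weights of the sums of `w` rows of `m`, as a counter. -/
def weightPlanes (m : Fin n → Fin n → Bool) (w : ℕ) : List ℕ :=
  (List.finRange n).foldr
    (fun j ss => addPlane ss (parityPlane ((List.finRange n).map (m · j)) w)) []

/-- The number of sets of `w` rows of `m` whose sum has weight `b`. -/
def rowSetCount (m : Fin n → Fin n → Bool) (w b : ℕ) : ℕ :=
  popCount ((n.choose w).log2 + 1) (selectPlane (weightPlanes m w) b (2 ^ n.choose w - 1))

lemma stores_weightPlanes (m : Fin n → Fin n → Bool) (w : ℕ) :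
    Stores ((List.finRange n).sublistsLen w) (weightPlanes m w)
      fun t => (List.finRange n).countP fun j => parity (t.map (m · j)) := by
  suffices ∀ l js : List (Fin n), Stores (l.sublistsLen w)
      (js.foldr (fun j ss => addPlane ss (parityPlane (l.map (m · j)) w)) [])
      fun t => js.countP fun j => parity (t.map (m · j)) from this _ _
  intro l js
  induction js with
  | nil => exact stores_nil _
  | cons j js ih =>
    rw [List.foldr_cons, parityPlane_map]
    convert ih.addPlane fun t => parity (t.map (m · j)) using 2 with t
    rw [List.countP_cons]
    cases parity (t.map (m · j)) <;> rfl

lemma rowSetCount_eq (m : Fin n → Fin n → Bool) (w b : ℕ) :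
    rowSetCount m w b = ((List.finRange n).sublistsLen w).countP fun t =>
      decide (((List.finRange n).countP fun j => parity (t.map (m · j))) = b) := by
  have hl : ((List.finRange n).sublistsLen w).length = n.choose w := by simp
  rw [rowSetCount, ← hl, ← pack_true, (stores_weightPlanes m w).selectPlane, popCount_eq,
    sum_testBit_pack _ _ Nat.lt_log2_self.le]
  simp

end Count


/-! ### Codes with a systematic generator matrix -/

section Code

variable {n : ℕ}

/-- The code generated by `(1 | M)`. -/
def systematicCode (M : Matrix (Fin n) (Fin n) (ZMod 2)) :
    Submodule (ZMod 2) (Fin (n + n) → ZMod 2) where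
  carrier := {v | (fun j => v (Fin.natAdd n j)) = (fun i => v (Fin.castAdd n i)) ᵥ* M}
  zero_mem' := (zero_vecMul M).symm
  add_mem' {v w} hv hw := by
    have := congrArg₂ (· + ·) hv hw
    rwa [← add_vecMul] at this
  smul_mem' c v hv := by
    have := congrArg (c • ·) hv
    rwa [← smul_vecMul] at this

lemma append_mem_systematicCode {M : Matrix (Fin n) (Fin n) (ZMod 2)} {u w : Fin n → ZMod 2} :
    Fin.append u w ∈ systematicCode M ↔ w = u ᵥ* M := by
  change (fun j => Fin.append u w (Fin.natAdd n j)) =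
    (fun i => Fin.append u w (Fin.castAdd n i)) ᵥ* M ↔ _
  simp only [Fin.append_left, Fin.append_right]

lemma sum_append_mul_append (p q u w : Fin n → ZMod 2) :
    ∑ i, Fin.append p q i * Fin.append u w i = p ⬝ᵥ u + q ⬝ᵥ w := by
  simp only [Fin.sum_univ_add, Fin.append_left, Fin.append_right, dotProduct]

lemma exists_eq_append (v : Fin (n + n) → ZMod 2) : ∃ p q, v = Fin.append p q :=
  ⟨_, _, Fin.append_castAdd_natAdd.symm⟩

lemma isSelfDual_systematicCode {M : Matrix (Fin n) (Fin n) (ZMod 2)} (hM : M * Mᵀ = 1) :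
    IsSelfDual (systematicCode M) := by
  have hM' : Mᵀ * M = 1 := mul_eq_one_comm.mp hM
  intro x
  obtain ⟨p, q, rfl⟩ := exists_eq_append x
  constructor
  · intro hx y hy
    obtain ⟨u, w, rfl⟩ := exists_eq_append y
    rw [append_mem_systematicCode] at hx hy
    rw [sum_append_mul_append, hx, hy, ← dotProduct_mulVec, ← mulVec_transpose, mulVec_mulVec,
      hM, one_mulVec, CharTwo.add_self_eq_zero]
  · intro h
    have key : p + M *ᵥ q = 0 := dotProduct_eq_zero _ fun u => by
      have := h (Fin.append u (u ᵥ* M)) (append_mem_systematicCode.mpr rfl)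
      rwa [sum_append_mul_append, dotProduct_comm q, ← dotProduct_mulVec, dotProduct_comm u,
        ← add_dotProduct] at this
    have hp : p = M *ᵥ q := by
      rw [eq_neg_of_add_eq_zero_left key]
      exact funext fun i => CharTwo.neg_eq _
    rw [append_mem_systematicCode, hp, ← mulVec_transpose, mulVec_mulVec, hM', one_mulVec]

lemma hamWt_append (u w : Fin n → ZMod 2) : hamWt (Fin.append u w) = hamWt u + hamWt w := by
  simp only [hamWt, card_filter, Fin.sum_univ_add, Fin.append_left, Fin.append_right]

/-- The number of vectors `u` of weight `a` for which `u ᵥ* M` has weight `b`. -/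
def jointWeightCount (M : Matrix (Fin n) (Fin n) (ZMod 2)) (a b : ℕ) : ℕ :=
  #{u : Fin n → ZMod 2 | hamWt u = a ∧ hamWt (u ᵥ* M) = b}

lemma jointWeightCount_transpose {M : Matrix (Fin n) (Fin n) (ZMod 2)} (hM : M * Mᵀ = 1)
    (a b : ℕ) : jointWeightCount M a b = jointWeightCount Mᵀ b a := by
  have hM' : Mᵀ * M = 1 := mul_eq_one_comm.mp hM
  refine card_bij' (fun u _ => u ᵥ* M) (fun w _ => w ᵥ* Mᵀ) ?_ ?_ ?_ ?_ <;>
    simp +contextual [vecMul_vecMul, hM, hM']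

lemma card_weight_systematicCode (M : Matrix (Fin n) (Fin n) (ZMod 2)) (k : ℕ) :
    Nat.card {v // v ∈ systematicCode M ∧ hamWt v = k} =
      ∑ a ∈ range (k + 1), jointWeightCount M a (k - a) := by
  have e : {v // v ∈ systematicCode M ∧ hamWt v = k} ≃
      {u : Fin n → ZMod 2 // hamWt u + hamWt (u ᵥ* M) = k} :=
    { toFun := fun v => ⟨fun i => v.1 (Fin.castAdd n i), by
        obtain ⟨v, hv, hk⟩ := v
        obtain ⟨p, q, rfl⟩ := exists_eq_append v
        rw [append_mem_systematicCode] at hv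
        simpa [hamWt_append, hv] using hk⟩
      invFun := fun u => ⟨Fin.append u.1 (u.1 ᵥ* M), append_mem_systematicCode.mpr rfl, by
        rw [hamWt_append, u.2]⟩
      left_inv := fun v => by
        obtain ⟨v, hv, hk⟩ := v
        obtain ⟨p, q, rfl⟩ := exists_eq_append v
        rw [append_mem_systematicCode] at hv
        simp [hv]
      right_inv := fun u => by simp }
  rw [Nat.card_congr e, Nat.card_eq_fintype_card, Fintype.card_subtype,
    card_eq_sum_card_fiberwise (f := hamWt) (t := range (k + 1))
      fun u hu => by simp at hu ⊢; omega]
  refine sum_congr rfl fun a ha => ?_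
  rw [jointWeightCount, filter_filter]
  congr 1
  ext u
  simp only [mem_filter, mem_univ, true_and, mem_range] at ha ⊢
  omega

/-- The matrix over `ZMod 2` with entries given by `m`. -/
def toMatrix (m : Fin n → Fin n → Bool) : Matrix (Fin n) (Fin n) (ZMod 2) :=
  of fun i j => if m i j then 1 else 0

lemma toMatrix_transpose (m : Fin n → Fin n → Bool) :
    (toMatrix m)ᵀ = toMatrix fun i j => m j i := rfl

lemma sum_map_eq_parity {ι : Type*} (t : List ι) (f : ι → Bool) :
    (t.map fun i => if f i then (1 : ZMod 2) else 0).sum =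
      if parity (t.map f) then 1 else 0 := by
  induction t with
  | nil => rfl
  | cons i t ih =>
    rw [List.map_cons, List.sum_cons, ih, List.map_cons]
    change _ = if (f i ^^ parity (t.map f)) then 1 else 0
    cases f i <;> cases parity (t.map f) <;> decide

lemma sum_map_ne_zero_iff {ι : Type*} (t : List ι) (f : ι → Bool) :
    (t.map fun i => if f i then (1 : ZMod 2) else 0).sum ≠ 0 ↔ parity (t.map f) := by
  simp [sum_map_eq_parity]

lemma toMatrix_mul_transpose_eq_one {m : Fin n → Fin n → Bool}
    (h : ∀ i j, parity ((List.finRange n).map fun k => m i k && m j k) = decide (i = j)) :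
    toMatrix m * (toMatrix m)ᵀ = 1 := by
  ext i j
  have key := sum_map_eq_parity (List.finRange n) fun k => m i k && m j k
  rw [h] at key
  rw [one_apply, mul_apply, ← List.sum_ofFn, List.ofFn_eq_map]
  simpa [toMatrix, ← ite_and, and_comm] using key

lemma hamWt_eq_countP (v : Fin n → ZMod 2) :
    hamWt v = (List.finRange n).countP fun j => decide (v j ≠ 0) := by
  exact (Multiset.countP_eq_card_filter (fun j => v j ≠ 0) univ.val).symm

lemma jointWeightCount_toMatrix (m : Fin n → Fin n → Bool) (a b : ℕ) :
    jointWeightCount (toMatrix m) a b = rowSetCount m a b := by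
  let rowSum (t : Multiset (Fin n)) : Fin n → ZMod 2 := fun j => (t.map (toMatrix m · j)).sum
  have h1 : jointWeightCount (toMatrix m) a b =
      #{s ∈ powersetCard a (univ : Finset (Fin n)) | hamWt (rowSum s.val) = b} := by
    have hz : ∀ x : ZMod 2, x ≠ 0 → x = 1 := by decide
    have hu (u : Fin n → ZMod 2) : (fun i => if u i ≠ 0 then (1 : ZMod 2) else 0) = u := by
      funext i
      by_cases h : u i = 0
      · simp [h]
      · simp [hz _ h]
    have hsum (s : Finset (Fin n)) :
        (fun i => if i ∈ s then (1 : ZMod 2) else 0) ᵥ* toMatrix m = rowSum s.val := by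
      funext j
      simp only [vecMul, dotProduct, ite_mul, one_mul, zero_mul, sum_ite_mem, univ_inter]
      rfl
    have hwt (s : Finset (Fin n)) :
        hamWt (fun i => if i ∈ s then (1 : ZMod 2) else 0) = s.card := by
      simp [hamWt]
    refine card_bij' (fun u _ => univ.filter (u · ≠ 0)) (fun s _ i => if i ∈ s then 1 else 0)
      (fun u hmem => ?_) (fun s hmem => ?_) (fun u _ => ?_) (fun s _ => ?_)
    · simp only [mem_filter, mem_univ, true_and, mem_powersetCard, subset_univ] at hmem ⊢
      refine ⟨hmem.1, ?_⟩
      rw [← hsum, ← hmem.2]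
      simp only [mem_filter, mem_univ, true_and, hu]
    · simp only [mem_filter, mem_univ, true_and, mem_powersetCard, subset_univ] at hmem ⊢
      rwa [hwt, hsum]
    · simp only [mem_filter, mem_univ, true_and, hu]
    · ext i
      simp
  have h2 (t : List (Fin n)) : hamWt (rowSum (t : Multiset (Fin n))) =
      (List.finRange n).countP fun j => parity (t.map (m · j)) := by
    rw [hamWt_eq_countP]
    refine List.countP_congr fun j _ => ?_
    rw [decide_eq_true_iff, ← sum_map_ne_zero_iff]
    rfl
  calc jointWeightCount (toMatrix m) a b
    _ = (powersetCard a (univ : Finset (Fin n))).val.countP (fun s => hamWt (rowSum s.val) = b) := by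
      rw [h1, Multiset.countP_eq_card_filter]
      rfl
    _ = (Multiset.powersetCard a (univ : Finset (Fin n)).val).countP
        (fun t => hamWt (rowSum t) = b) := by
      rw [← map_val_val_powersetCard, Multiset.countP_map, Multiset.countP_eq_card_filter]
    _ = (Multiset.powersetCard a (List.finRange n : Multiset (Fin n))).countP
        (fun t => hamWt (rowSum t) = b) := rfl
    _ = rowSetCount m a b := by
      rw [Multiset.powersetCard_coe, Multiset.coe_countP, List.countP_map, rowSetCount_eq]
      exact List.countP_congr fun t _ => by simp [h2]

/-- The number of codewords of weight `k` of the code generated by `(1 | m)` for an orthogonal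
matrix `m`, obtained from the sets of at most `k / 2` rows or columns of `m`. -/
def wordCount (m : Fin n → Fin n → Bool) (k : ℕ) : ℕ :=
  ∑ a ∈ range (k / 2 + 1), rowSetCount m a (k - a) +
    ∑ b ∈ range ((k + 1) / 2), rowSetCount (fun i j => m j i) b (k - b)

lemma card_weight_eq_wordCount {m : Fin n → Fin n → Bool}
    (hm : toMatrix m * (toMatrix m)ᵀ = 1) (k : ℕ) :
    Nat.card {v // v ∈ systematicCode (toMatrix m) ∧ hamWt v = k} = wordCount m k := by
  rw [card_weight_systematicCode, wordCount, show k + 1 = k / 2 + 1 + (k + 1) / 2 by omega,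
    sum_range_add]
  congr 1
  · exact sum_congr rfl fun a _ => jointWeightCount_toMatrix m a _
  · rw [← sum_range_reflect]
    refine sum_congr (by congr 1; omega) fun b hb => ?_
    rw [mem_range] at hb
    rw [jointWeightCount_transpose hm, toMatrix_transpose, jointWeightCount_toMatrix]
    congr 1 <;> omega

end Code

/-! ### A four-circulant code of length 72 -/

/-- The matrix `(A, B; Bᵀ, Aᵀ)`, where `A` and `B` are the circulant matrices of order `18`
whose first rows are the binary digits of `139429` and `93614`. -/
def fourCirculant (i j : Fin 36) : Bool :=
  bif Nat.blt i 18 then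
    bif Nat.blt j 18 then Nat.testBit 139429 ((j + 18 - i) % 18)
    else Nat.testBit 93614 ((j - i) % 18)
  else
    bif Nat.blt j 18 then Nat.testBit 93614 ((i - j) % 18)
    else Nat.testBit 139429 ((i + 18 - j) % 18)

lemma fourCirculant_mul_transpose : toMatrix fourCirculant * (toMatrix fourCirculant)ᵀ = 1 :=
  toMatrix_mul_transpose_eq_one (by decide +kernel)

lemma wordCount_fourCirculant_of_lt :
    ∀ k < 12, 0 < k → wordCount fourCirculant k = 0 := by
  decide +kernel

lemma wordCount_fourCirculant_twelve : wordCount fourCirculant 12 = 600 := by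
  decide +kernel

lemma wordCount_fourCirculant_fourteen : wordCount fourCirculant 14 = 7488 := by
  decide +kernel

end BitSlice

/-- There is a self-dual binary linear code of length 72 with minimum nonzero Hamming
weight 12, having exactly 600 codewords of weight 12 and exactly 7488 codewords of
weight 14 (weight enumerator `W_{72,1}` with γ = 18 and β = 300). -/
theorem exists_selfDual_code_72_gamma_18_beta_300 :
    ∃ C : Submodule (ZMod 2) (Fin 72 → ZMod 2),
      IsSelfDual C ∧
      IsLeast {k | ∃ v ∈ C, v ≠ 0 ∧ hamWt v = k} 12 ∧
      Nat.card {v : Fin 72 → ZMod 2 // v ∈ C ∧ hamWt v = 12} = 600 ∧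
      Nat.card {v : Fin 72 → ZMod 2 // v ∈ C ∧ hamWt v = 14} = 7488 := by
  open BitSlice in
  have hm := fourCirculant_mul_transpose
  have h12 := (card_weight_eq_wordCount hm 12).trans wordCount_fourCirculant_twelve
  refine ⟨systematicCode (toMatrix fourCirculant), isSelfDual_systematicCode hm, ⟨?_, ?_⟩, h12,
    (card_weight_eq_wordCount hm 14).trans wordCount_fourCirculant_fourteen⟩
  · have : Nonempty {v // v ∈ systematicCode (toMatrix fourCirculant) ∧ hamWt v = 12} :=
      (Nat.card_pos_iff.mp (by rw [h12]; norm_num)).1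
    obtain ⟨v, hv, hk⟩ := this
    refine ⟨v, hv, ?_, hk⟩
    rintro rfl
    simp [hamWt] at hk
  · rintro k ⟨v, hv, hne, hk⟩
    by_contra! hlt
    have hpos : 0 < k := by
      rw [← hk, hamWt, Finset.card_pos]
      obtain ⟨i, hi⟩ := Function.ne_iff.mp hne
      exact ⟨i, by simpa using hi⟩
    have h0 := (card_weight_eq_wordCount hm k).trans (wordCount_fourCirculant_of_lt k hlt hpos)
    have : Nonempty {v // v ∈ systematicCode (toMatrix fourCirculant) ∧ hamWt v = k} :=
      ⟨⟨v, hv, hk⟩⟩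
    exact Nat.card_pos.ne' h0
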